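/- Let n ≥ 2 and let G ⊆ ℝⁿ be a bounded subregion. Define the isoperimetric profile ℓ : [0, Lⁿ(G)) → ℝ by ℓ(A) := inf{ Per(E) : E ⊆ cl(G) Lebesgue measurable with Lⁿ(E) = A }. Then ℓ is strictly increasing: for all 0 ≤ A < A' < Lⁿ(G) one has ℓ(A) < ℓ(A'). -/

import Mathlib

open MeasureTheory
open scoped ENNReal

/-- The divergence of a vector field on `ℝⁿ`. -/
noncomputable def vecDiv {n : ℕ} (φ : EuclideanSpace ℝ (Fin n) → EuclideanSpace ℝ (Fin n))
    (x : EuclideanSpace ℝ (Fin n)) : ℝ :=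
  ∑ i : Fin n, fderiv ℝ φ x (EuclideanSpace.single i 1) i

/-- The perimeter of a set `E` relative to an open set `F`:
`Per(E;F) = sup { ∫_E div φ dx : φ ∈ C¹_0(F, ℝⁿ), |φ| ≤ 1 }`. -/
noncomputable def perIn {n : ℕ} (E F : Set (EuclideanSpace ℝ (Fin n))) : ℝ≥0∞ :=
  ⨆ φ : {φ : EuclideanSpace ℝ (Fin n) → EuclideanSpace ℝ (Fin n) //
      ContDiff ℝ 1 φ ∧ HasCompactSupport φ ∧ tsupport φ ⊆ F ∧ ∀ x, ‖φ x‖ ≤ 1},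
    ENNReal.ofReal (∫ x in E, vecDiv φ.1 x)

/-- The perimeter of `E` (relative to all of `ℝⁿ`). -/
noncomputable def per {n : ℕ} (E : Set (EuclideanSpace ℝ (Fin n))) : ℝ≥0∞ :=
  perIn E Set.univ

/-- The isoperimetric profile of `G`:
`ℓ(A) = inf { Per(E) : E ⊆ cl(G) measurable, Lⁿ(E) = A }`. -/
noncomputable def isoProfile {n : ℕ} (G : Set (EuclideanSpace ℝ (Fin n))) (A : ℝ≥0∞) : ℝ≥0∞ :=
  sInf {P : ℝ≥0∞ | ∃ E : Set (EuclideanSpace ℝ (Fin n)),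
    MeasurableSet E ∧ E ⊆ closure G ∧ volume E = A ∧ per E = P}

lemma vecDiv_add {n : ℕ} {φ ψ : EuclideanSpace ℝ (Fin n) → EuclideanSpace ℝ (Fin n)}
    {x : EuclideanSpace ℝ (Fin n)} (hφ : DifferentiableAt ℝ φ x) (hψ : DifferentiableAt ℝ ψ x) :
    vecDiv (fun y => φ y + ψ y) x = vecDiv φ x + vecDiv ψ x := by
  simp [vecDiv, fderiv_fun_add hφ hψ, Finset.sum_add_distrib]

lemma vecDiv_sub {n : ℕ} {φ ψ : EuclideanSpace ℝ (Fin n) → EuclideanSpace ℝ (Fin n)}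
    {x : EuclideanSpace ℝ (Fin n)} (hφ : DifferentiableAt ℝ φ x) (hψ : DifferentiableAt ℝ ψ x) :
    vecDiv (fun y => φ y - ψ y) x = vecDiv φ x - vecDiv ψ x := by
  simp [vecDiv, fderiv_fun_sub hφ hψ, Finset.sum_sub_distrib]

lemma vecDiv_smul {n : ℕ} {f : EuclideanSpace ℝ (Fin n) → ℝ}
    {φ : EuclideanSpace ℝ (Fin n) → EuclideanSpace ℝ (Fin n)}
    {x : EuclideanSpace ℝ (Fin n)} (hf : DifferentiableAt ℝ f x) (hφ : DifferentiableAt ℝ φ x) :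
    vecDiv (fun y => f y • φ y) x = f x * vecDiv φ x + fderiv ℝ f x (φ x) := by
  have hsum : φ x = ∑ i, φ x i • EuclideanSpace.single i (1 : ℝ) := by
    ext j
    simp [Finset.sum_apply, Pi.single_apply]
  conv_rhs => rw [hsum]
  simp [vecDiv, fderiv_fun_smul hf hφ, Finset.sum_add_distrib, Finset.mul_sum, mul_comm]

lemma continuous_vecDiv {n : ℕ} {φ : EuclideanSpace ℝ (Fin n) → EuclideanSpace ℝ (Fin n)}
    (hφ : ContDiff ℝ 1 φ) : Continuous (vecDiv φ) := by
  have h := hφ.continuous_fderiv one_ne_zero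
  unfold vecDiv
  fun_prop

lemma integrable_vecDiv {n : ℕ} {φ : EuclideanSpace ℝ (Fin n) → EuclideanSpace ℝ (Fin n)}
    (hφ : ContDiff ℝ 1 φ) (hc : HasCompactSupport φ) : Integrable (vecDiv φ) := by
  refine (continuous_vecDiv hφ).integrable_of_hasCompactSupport ?_
  refine (hc.fderiv ℝ).mono fun x hx => ?_
  contrapose! hx
  simp only [Function.mem_support, not_not] at hx
  simp [vecDiv, hx]

lemma ofReal_integral_vecDiv_le_per {n : ℕ} (E : Set (EuclideanSpace ℝ (Fin n)))
    {φ : EuclideanSpace ℝ (Fin n) → EuclideanSpace ℝ (Fin n)}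
    (hφ : ContDiff ℝ 1 φ) (hc : HasCompactSupport φ) (hb : ∀ x, ‖φ x‖ ≤ 1) :
    ENNReal.ofReal (∫ x in E, vecDiv φ x) ≤ per E :=
  le_iSup (fun φ : {φ : EuclideanSpace ℝ (Fin n) → EuclideanSpace ℝ (Fin n) //
      ContDiff ℝ 1 φ ∧ HasCompactSupport φ ∧ tsupport φ ⊆ Set.univ ∧ ∀ x, ‖φ x‖ ≤ 1} =>
    ENNReal.ofReal (∫ x in E, vecDiv φ.1 x)) ⟨φ, hφ, hc, Set.subset_univ _, hb⟩

lemma continuous_coord {n : ℕ} (i : Fin n) :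
    Continuous fun x : EuclideanSpace ℝ (Fin n) => x i :=
  (EuclideanSpace.proj (𝕜 := ℝ) i).continuous

lemma fderiv_comp_coord {n : ℕ} {g : ℝ → ℝ} {g' : ℝ} {i : Fin n} {x : EuclideanSpace ℝ (Fin n)}
    (hg : HasDerivAt g g' (x i)) (v : EuclideanSpace ℝ (Fin n)) :
    fderiv ℝ (fun y : EuclideanSpace ℝ (Fin n) => g (y i)) x v = g' * v i := by
  have h : HasFDerivAt (fun y : EuclideanSpace ℝ (Fin n) => y i)
      (EuclideanSpace.proj (𝕜 := ℝ) i) x := (EuclideanSpace.proj (𝕜 := ℝ) i).hasFDerivAt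
  have h2 := hg.comp_hasFDerivAt x h
  rw [show (fun y : EuclideanSpace ℝ (Fin n) => g (y i)) = g ∘ fun y => y i from rfl, h2.fderiv]
  simp

/-- A smooth antitone step function, equal to `1` on `(-∞, t - 1/(m+1)]` and to `0` on
`[t, ∞)`. -/
noncomputable def stepDown (t : ℝ) (m : ℕ) (u : ℝ) : ℝ :=
  Real.smoothTransition ((m + 1) * (t - u))

lemma contDiff_stepDown (t : ℝ) (m : ℕ) : ContDiff ℝ 1 (stepDown t m) := by
  have : ContDiff ℝ 1 Real.smoothTransition := Real.smoothTransition.contDiff (n := 1)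
  exact this.comp (by fun_prop)

lemma stepDown_nonneg (t : ℝ) (m : ℕ) (u : ℝ) : 0 ≤ stepDown t m u :=
  Real.smoothTransition.nonneg _

lemma stepDown_le_one (t : ℝ) (m : ℕ) (u : ℝ) : stepDown t m u ≤ 1 :=
  Real.smoothTransition.le_one _

lemma antitone_stepDown (t : ℝ) (m : ℕ) : Antitone (stepDown t m) := fun u v huv =>
  Real.smoothTransition.monotone (by gcongr)

lemma stepDown_of_le {t u : ℝ} (m : ℕ) (h : t ≤ u) : stepDown t m u = 0 :=
  Real.smoothTransition.zero_of_nonpos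
    (mul_nonpos_of_nonneg_of_nonpos (by positivity) (by linarith))

lemma deriv_stepDown_nonpos (t : ℝ) (m : ℕ) (u : ℝ) : deriv (stepDown t m) u ≤ 0 :=
  (antitone_stepDown t m).deriv_nonpos

lemma deriv_stepDown_of_lt {t u : ℝ} (m : ℕ) (h : t < u) : deriv (stepDown t m) u = 0 := by
  have : stepDown t m =ᶠ[nhds u] fun _ => 0 := by
    filter_upwards [lt_mem_nhds h] with v hv using stepDown_of_le m hv.le
  rw [this.deriv_eq]; simp

lemma tendsto_stepDown (t u : ℝ) :
    Filter.Tendsto (fun m => stepDown t m u) Filter.atTop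
      (nhds (if u < t then 1 else 0)) := by
  split_ifs with h
  · obtain ⟨N, hN⟩ := exists_nat_gt (1 / (t - u))
    refine tendsto_const_nhds.congr' ?_
    filter_upwards [Filter.eventually_ge_atTop N] with m hm
    refine (Real.smoothTransition.one_of_one_le ?_).symm
    have hpos : 0 < t - u := by linarith
    rw [div_lt_iff₀ hpos] at hN
    have : (N : ℝ) ≤ m := by exact_mod_cast hm
    nlinarith
  · simp only [stepDown_of_le _ (not_lt.1 h)]
    exact tendsto_const_nhds

/-- Gluing a test field on the lower half of a set to a field that leaves the cutting hyperplane
in the normal direction. -/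
lemma ofReal_integral_add_integral_le_per {n : ℕ} {E : Set (EuclideanSpace ℝ (Fin n))}
    (hE : MeasurableSet E) (i : Fin n) (t : ℝ)
    {φ W : EuclideanSpace ℝ (Fin n) → EuclideanSpace ℝ (Fin n)}
    (hφ : ContDiff ℝ 1 φ) (hφc : HasCompactSupport φ) (hφb : ∀ x, ‖φ x‖ ≤ 1)
    (hW : ContDiff ℝ 1 W) (hWc : HasCompactSupport W) (hWb : ∀ x, ‖W x‖ ≤ 1)
    (hWE : ∀ x ∈ E, x i ≤ t → W x i = 1) :
    ENNReal.ofReal ((∫ x in E ∩ {x | x i < t}, vecDiv φ x) +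
      ∫ x in E ∩ {x | t ≤ x i}, vecDiv W x) ≤ per E := by
  have hH : MeasurableSet {x : EuclideanSpace ℝ (Fin n) | x i < t} :=
    (isOpen_lt (continuous_coord i) continuous_const).measurableSet
  have hdφ := hφ.differentiable one_ne_zero
  have hdW := hW.differentiable one_ne_zero
  have hiφ := integrable_vecDiv hφ hφc
  have hiW := integrable_vecDiv hW hWc
  set χ : ℕ → EuclideanSpace ℝ (Fin n) → ℝ := fun m x => stepDown t m (x i) with hχ
  have hχC : ∀ m, ContDiff ℝ 1 (χ m) := fun m =>
    (contDiff_stepDown t m).comp (EuclideanSpace.proj (𝕜 := ℝ) i).contDiff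
  set ψ : ℕ → EuclideanSpace ℝ (Fin n) → EuclideanSpace ℝ (Fin n) :=
    fun m x => W x + χ m x • (φ x - W x) with hψ
  have hψC : ∀ m, ContDiff ℝ 1 (ψ m) := fun m => hW.add ((hχC m).smul (hφ.sub hW))
  have hψc : ∀ m, HasCompactSupport (ψ m) := fun m => by
    have hs : HasCompactSupport fun x => φ x - W x := hφc.sub hWc
    have h2 : HasCompactSupport fun x => χ m x • (φ x - W x) := hs.smul_left (f := χ m)
    exact hWc.add h2
  have hψb : ∀ m x, ‖ψ m x‖ ≤ 1 := fun m x => by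
    have h0 := stepDown_nonneg t m (x i)
    have h1 := stepDown_le_one t m (x i)
    have : ψ m x = (1 - χ m x) • W x + χ m x • φ x := by
      simp only [hψ]; module
    rw [this]
    calc ‖(1 - χ m x) • W x + χ m x • φ x‖ ≤ ‖(1 - χ m x) • W x‖ + ‖χ m x • φ x‖ := norm_add_le _ _
      _ = (1 - χ m x) * ‖W x‖ + χ m x * ‖φ x‖ := by
        rw [norm_smul, norm_smul, Real.norm_of_nonneg h0, Real.norm_of_nonneg (by linarith)]
      _ ≤ (1 - χ m x) * 1 + χ m x * 1 := by
        gcongr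
        · exact hWb x
        · exact hφb x
      _ = 1 := by ring
  have hdiv : ∀ m, ∀ x ∈ E,
      vecDiv W x + χ m x * (vecDiv φ x - vecDiv W x) ≤ vecDiv (ψ m) x := by
    intro m x hx
    have hdχ : DifferentiableAt ℝ (χ m) x := (hχC m).differentiable one_ne_zero x
    have e : vecDiv (ψ m) x = vecDiv W x + (χ m x * (vecDiv φ x - vecDiv W x) +
        deriv (stepDown t m) (x i) * (φ x - W x) i) := by
      rw [hψ, vecDiv_add (hdW x) (hdχ.fun_smul ((hdφ x).fun_sub (hdW x))),
        vecDiv_smul hdχ ((hdφ x).fun_sub (hdW x)), vecDiv_sub (hdφ x) (hdW x),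
        fderiv_comp_coord ((contDiff_stepDown t m).differentiable one_ne_zero _).hasDerivAt]
    have hpos : 0 ≤ deriv (stepDown t m) (x i) * (φ x - W x) i := by
      rcases le_or_gt (x i) t with h | h
      · refine mul_nonneg_of_nonpos_of_nonpos (deriv_stepDown_nonpos t m _) ?_
        have h1 : φ x i ≤ 1 :=
          (le_abs_self _).trans ((PiLp.norm_apply_le (φ x) i).trans (hφb x))
        simp only [PiLp.sub_apply, hWE x hx h]
        linarith
      · simp [deriv_stepDown_of_lt m h]
    rw [e]
    linarith
  have hmeas : ∀ m, AEStronglyMeasurable (χ m) (volume.restrict E) :=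
    fun m => (hχC m).continuous.aestronglyMeasurable
  have hint : ∀ m, Integrable (fun x => χ m x * (vecDiv φ x - vecDiv W x)) (volume.restrict E) :=
    fun m => ((hiφ.sub hiW).restrict (s := E)).bdd_mul (hmeas m) (c := 1)
      (Filter.Eventually.of_forall fun x => by
        rw [Real.norm_of_nonneg (stepDown_nonneg t m _)]; exact stepDown_le_one t m _)
  have hlim : Filter.Tendsto (fun m => ∫ x in E, χ m x * (vecDiv φ x - vecDiv W x)) Filter.atTop
      (nhds (∫ x in E, {x | x i < t}.indicator (fun x => vecDiv φ x - vecDiv W x) x)) := by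
    refine tendsto_integral_of_dominated_convergence (fun x => ‖vecDiv φ x - vecDiv W x‖)
      (fun m => (hint m).aestronglyMeasurable) (hiφ.sub hiW).norm.restrict ?_ ?_
    · refine fun m => Filter.Eventually.of_forall fun x => ?_
      rw [norm_mul, Real.norm_of_nonneg (stepDown_nonneg t m _)]
      exact mul_le_of_le_one_left (norm_nonneg _) (stepDown_le_one t m _)
    · refine Filter.Eventually.of_forall fun x => ?_
      have := (tendsto_stepDown t (x i)).mul_const (vecDiv φ x - vecDiv W x)
      convert this using 2
      by_cases h : x i < t <;> simp [Set.indicator, h]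
  have hval : (∫ x in E, vecDiv W x) +
      (∫ x in E, {x | x i < t}.indicator (fun x => vecDiv φ x - vecDiv W x) x) =
      (∫ x in E ∩ {x | x i < t}, vecDiv φ x) + ∫ x in E ∩ {x | t ≤ x i}, vecDiv W x := by
    rw [setIntegral_indicator hH, integral_sub hiφ.integrableOn hiW.integrableOn,
      ← integral_inter_add_sdiff hH hiW.integrableOn,
      show E \ {x | x i < t} = E ∩ {x | t ≤ x i} by ext; simp]
    ring
  rw [← hval]
  refine le_of_tendsto (ENNReal.tendsto_ofReal (hlim.const_add _))
    (Filter.Eventually.of_forall fun m => ?_)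
  refine le_trans (ENNReal.ofReal_le_ofReal ?_)
    (ofReal_integral_vecDiv_le_per E (hψC m) (hψc m) (hψb m))
  rw [← integral_add hiW.restrict (hint m)]
  exact setIntegral_mono_on (hiW.restrict.add (hint m))
    (integrable_vecDiv (hψC m) (hψc m)).restrict hE (hdiv m)

lemma hasDerivAt_max_zero_sq (u : ℝ) :
    HasDerivAt (fun u : ℝ => max u 0 ^ 2) (2 * max u 0) u := by
  rcases lt_trichotomy u 0 with h | rfl | h
  · rw [max_eq_right h.le]
    have : (fun u : ℝ => max u 0 ^ 2) =ᶠ[nhds u] fun _ => 0 := by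
      filter_upwards [gt_mem_nhds h] with v hv
      simp [max_eq_right hv.le]
    simpa using (hasDerivAt_const u (0 : ℝ)).congr_of_eventuallyEq this
  · rw [max_self, mul_zero, hasDerivAt_iff_isLittleO]
    have h1 : (fun v : ℝ => max v 0 ^ 2) =O[nhds 0] fun v => v ^ 2 := by
      refine Asymptotics.IsBigO.of_bound 1 (Filter.Eventually.of_forall fun v => ?_)
      rcases le_total v 0 with hv | hv <;> simp [hv, sq_nonneg]
    have h2 : (fun v : ℝ => v ^ 2) =o[nhds 0] fun v => v := by
      simpa using Asymptotics.isLittleO_pow_pow (𝕜 := ℝ) (one_lt_two (α := ℕ))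
    simpa using h1.trans_isLittleO h2
  · rw [max_eq_left h.le]
    have : (fun u : ℝ => max u 0 ^ 2) =ᶠ[nhds u] fun u => u ^ 2 := by
      filter_upwards [lt_mem_nhds h] with v hv
      simp [max_eq_left hv.le]
    simpa using (hasDerivAt_pow 2 u).congr_of_eventuallyEq this

lemma contDiff_max_zero_sq : ContDiff ℝ 1 (fun u : ℝ => max u 0 ^ 2) := by
  rw [contDiff_one_iff_deriv]
  refine ⟨fun u => (hasDerivAt_max_zero_sq u).differentiableAt, ?_⟩
  rw [show deriv (fun u : ℝ => max u 0 ^ 2) = fun u => 2 * max u 0 from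
    funext fun u => (hasDerivAt_max_zero_sq u).deriv]
  fun_prop

/-- A field of norm at most one which is normal to the hyperplane `x i = t` below it, bends
sideways above it, and has positive divergence there. -/
lemma exists_bending_field {n : ℕ} {i j : Fin n} (hij : i ≠ j) {R t : ℝ} (hR : 0 < R)
    (ht : |t| ≤ R) :
    ∃ W : EuclideanSpace ℝ (Fin n) → EuclideanSpace ℝ (Fin n),
      ContDiff ℝ 1 W ∧ HasCompactSupport W ∧ (∀ x, ‖W x‖ ≤ 1) ∧
      ∀ x ∈ Metric.closedBall (0 : EuclideanSpace ℝ (Fin n)) R,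
        (x i ≤ t → W x i = 1) ∧ max (x i - t) 0 ^ 2 / (192 * R ^ 3) ≤ vecDiv W x := by
  obtain ⟨ht1, ht2⟩ := abs_le.1 ht
  set k : ℝ := 1 / (48 * R ^ 2) with hk
  have hkR : k * R ^ 2 = 1 / 48 := by rw [hk]; field_simp
  have hk0 : 0 < k := by positivity
  let S : ℝ → ℝ := fun u => max (u - t) 0 ^ 2
  have hSd : ∀ u, HasDerivAt S (2 * max (u - t) 0) u := fun u => by
    have h := (hasDerivAt_max_zero_sq (u - t)).comp u ((hasDerivAt_id u).sub_const t)
    rw [mul_one] at h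
    exact h
  have hSC : ContDiff ℝ 1 S := contDiff_max_zero_sq.comp (contDiff_id.sub contDiff_const)
  have hS0 : ∀ u, 0 ≤ S u := fun u => sq_nonneg _
  have hpi : ∀ l : Fin n, ContDiff ℝ 1 (fun x : EuclideanSpace ℝ (Fin n) => x l) :=
    fun l => (EuclideanSpace.proj (𝕜 := ℝ) l).contDiff
  let a : ℝ → ℝ := fun u => 1 - k ^ 2 * S u ^ 2
  have had : ∀ u, HasDerivAt a (-(k ^ 2 * (2 * S u * (2 * max (u - t) 0)))) u := fun u => by
    simpa using (((hSd u).pow 2).const_mul (k ^ 2)).const_sub 1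
  let b : EuclideanSpace ℝ (Fin n) → ℝ := fun x => (k / (2 * R) * S (x i)) * x j
  have haC : ContDiff ℝ 1 fun x : EuclideanSpace ℝ (Fin n) => a (x i) :=
    contDiff_const.sub (contDiff_const.mul ((hSC.comp (hpi i)).pow 2))
  have hSiC : ContDiff ℝ 1 fun x : EuclideanSpace ℝ (Fin n) => k / (2 * R) * S (x i) :=
    contDiff_const.mul (hSC.comp (hpi i))
  have hbC : ContDiff ℝ 1 b := hSiC.mul (hpi j)
  let w : EuclideanSpace ℝ (Fin n) → EuclideanSpace ℝ (Fin n) := fun x =>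
    a (x i) • EuclideanSpace.single i (1 : ℝ) + b x • EuclideanSpace.single j (1 : ℝ)
  have hwC : ContDiff ℝ 1 w := (haC.smul contDiff_const).add (hbC.smul contDiff_const)
  have hwi : ∀ x, w x i = a (x i) := fun x => by simp [w, hij]
  have hnorm : ∀ x ∈ Metric.ball (0 : EuclideanSpace ℝ (Fin n)) (2 * R), ‖w x‖ ≤ 1 := by
    intro x hx
    rw [mem_ball_zero_iff] at hx
    have hi := abs_le.1 ((PiLp.norm_apply_le x i).trans hx.le)
    have hj := (PiLp.norm_apply_le x j).trans hx.le
    have hm0 : 0 ≤ max (x i - t) 0 := le_max_right _ _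
    have hm : max (x i - t) 0 ≤ 3 * R := max_le (by linarith [hi.2]) (by linarith)
    have hkS : k * S (x i) ≤ 1 := by
      have : S (x i) ≤ (3 * R) ^ 2 := pow_le_pow_left₀ hm0 hm 2
      nlinarith
    have hkS0 : 0 ≤ k * S (x i) := mul_nonneg hk0.le (hS0 _)
    have hsq : ‖w x‖ ^ 2 = a (x i) ^ 2 + b x ^ 2 := by
      have ho : inner ℝ (EuclideanSpace.single i (1 : ℝ)) (EuclideanSpace.single j (1 : ℝ)) = 0 := by
        simp [EuclideanSpace.inner_single_left, hij]
      change ‖a (x i) • EuclideanSpace.single i (1 : ℝ) +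
        b x • EuclideanSpace.single j (1 : ℝ)‖ ^ 2 = _
      rw [norm_add_sq_real, inner_smul_left, inner_smul_right, ho]
      simp [norm_smul]
    have hb : b x ^ 2 ≤ (k * S (x i)) ^ 2 := by
      have hxj : |x j / (2 * R)| ≤ 1 := by
        rw [abs_div, abs_of_pos (by positivity : 0 < 2 * R)]
        exact (div_le_one (by positivity)).2 hj
      have hxj2 : (x j / (2 * R)) ^ 2 ≤ 1 := (sq_le_one_iff_abs_le_one _).2 hxj
      calc b x ^ 2 = (k * S (x i)) ^ 2 * (x j / (2 * R)) ^ 2 := by simp only [b]; ring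
        _ ≤ (k * S (x i)) ^ 2 := mul_le_of_le_one_right (sq_nonneg _) hxj2
    have ha : a (x i) = 1 - (k * S (x i)) ^ 2 := by simp only [a]; ring
    have : ‖w x‖ ^ 2 ≤ 1 ^ 2 := by
      rw [hsq, ha]
      have : (k * S (x i)) ^ 2 ≤ 1 := pow_le_one₀ hkS0 hkS
      nlinarith [sq_nonneg (k * S (x i))]
    exact le_of_sq_le_sq this zero_le_one
  let θ : ContDiffBump (0 : EuclideanSpace ℝ (Fin n)) := ⟨3 / 2 * R, 2 * R, by positivity, by linarith⟩
  refine ⟨fun x => θ x • w x, θ.contDiff.smul hwC, θ.hasCompactSupport.smul_right, ?_, ?_⟩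
  · intro x
    by_cases hx : x ∈ Metric.ball (0 : EuclideanSpace ℝ (Fin n)) (2 * R)
    · rw [norm_smul, Real.norm_of_nonneg θ.nonneg]
      exact mul_le_one₀ θ.le_one (norm_nonneg _) (hnorm x hx)
    · have : θ x = 0 := by
        rw [← Function.notMem_support, θ.support_eq]; exact hx
      simp [this]
  · intro x hx
    rw [mem_closedBall_zero_iff] at hx
    have hev : (fun x => θ x • w x) =ᶠ[nhds x] w := by
      have : Metric.ball (0 : EuclideanSpace ℝ (Fin n)) (3 / 2 * R) ∈ nhds x :=
        Metric.isOpen_ball.mem_nhds (by rw [mem_ball_zero_iff]; linarith)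
      filter_upwards [this] with y hy
      rw [θ.one_of_mem_closedBall (Metric.ball_subset_closedBall hy), one_smul]
    refine ⟨fun hxt => ?_, ?_⟩
    · have : θ x • w x = w x := hev.eq_of_nhds
      change (θ x • w x) i = 1
      rw [this, hwi]
      simp [a, S, hxt]
    have hdiv : vecDiv (fun x => θ x • w x) x = vecDiv w x := by
      simp only [vecDiv, hev.fderiv_eq]
    have hda := haC.differentiable one_ne_zero x
    have hdb := hbC.differentiable one_ne_zero x
    have hdS := hSiC.differentiable one_ne_zero x
    have hconst : ∀ v : EuclideanSpace ℝ (Fin n), vecDiv (fun _ => v) x = 0 := fun v => by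
      simp [vecDiv]
    have hfb : fderiv ℝ b x (EuclideanSpace.single j 1) = k / (2 * R) * S (x i) := by
      have hj := (hpi j).differentiable one_ne_zero x
      have e1 := fderiv_comp_coord (i := i) (x := x) ((hSd (x i)).const_mul (k / (2 * R)))
        (EuclideanSpace.single j (1 : ℝ))
      have e2 := fderiv_comp_coord (i := j) (x := x) (hasDerivAt_id (x j))
        (EuclideanSpace.single j (1 : ℝ))
      simp only [b]
      rw [fderiv_fun_mul hdS hj]
      simp only [id] at e2
      simp [e1, e2, hij]
    have hw : vecDiv w x = -(k ^ 2 * (2 * S (x i) * (2 * max (x i - t) 0))) +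
        k / (2 * R) * S (x i) := by
      rw [vecDiv_add (hda.fun_smul (differentiableAt_const _))
        (hdb.fun_smul (differentiableAt_const _)), vecDiv_smul hda (differentiableAt_const _),
        vecDiv_smul hdb (differentiableAt_const _), hconst, hconst, hfb,
        fderiv_comp_coord (had (x i))]
      simp
    rw [hdiv, hw]
    have hi := abs_le.1 ((PiLp.norm_apply_le x i).trans hx)
    have hm : max (x i - t) 0 ≤ 2 * R := max_le (by linarith [hi.2]) (by linarith)
    have e : k / (2 * R) * S (x i) = k * S (x i) * (24 * R * k) := by
      simp only [hk]; field_simp; ring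
    have e3 : max (x i - t) 0 ^ 2 / (192 * R ^ 3) = k * S (x i) * (12 * R * k) := by
      simp only [hk, S]; field_simp; ring
    have : k ^ 2 * S (x i) * max (x i - t) 0 ≤ k ^ 2 * S (x i) * (2 * R) :=
      mul_le_mul_of_nonneg_left hm (mul_nonneg (by positivity) (hS0 _))
    have h0 : 0 ≤ k ^ 2 * S (x i) * R := mul_nonneg (mul_nonneg (by positivity) (hS0 _)) hR.le
    rw [e, e3]
    nlinarith

lemma volume_slab_le {n : ℕ} (i : Fin n) (R s t : ℝ) :
    volume (Metric.closedBall (0 : EuclideanSpace ℝ (Fin n)) R ∩ {x | s ≤ x i ∧ x i ≤ t}) ≤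
      ENNReal.ofReal (t - s) * ENNReal.ofReal (2 * R) ^ (n - 1) := by
  set B : Set (Fin n → ℝ) := Set.Icc (Function.update (fun _ => -R) i s)
    (Function.update (fun _ => R) i t)
  have hsub : Metric.closedBall (0 : EuclideanSpace ℝ (Fin n)) R ∩ {x | s ≤ x i ∧ x i ≤ t} ⊆
      (WithLp.ofLp) ⁻¹' B := by
    rintro x ⟨hx, h1, h2⟩
    rw [mem_closedBall_zero_iff] at hx
    have hl : ∀ l, -R ≤ x l ∧ x l ≤ R := fun l => abs_le.1 ((PiLp.norm_apply_le x l).trans hx)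
    refine ⟨fun l => ?_, fun l => ?_⟩ <;> by_cases h : l = i
    · subst h; simpa using h1
    · simpa [h] using (hl l).1
    · subst h; simpa using h2
    · simpa [h] using (hl l).2
  refine (measure_mono hsub).trans ?_
  rw [(PiLp.volume_preserving_ofLp (Fin n)).measure_preimage measurableSet_Icc.nullMeasurableSet,
    Real.volume_Icc_pi, ← Finset.mul_prod_erase _ _ (Finset.mem_univ i)]
  refine le_of_eq ?_
  congr 1
  · simp
  · rw [Finset.prod_congr rfl (g := fun _ => ENNReal.ofReal (2 * R))]
    · simp
    · intro l hl
      rw [Finset.mem_erase] at hl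
      rw [Function.update_of_ne hl.1, Function.update_of_ne hl.1]
      congr 1; ring

lemma per_inter_add_le_per {n : ℕ} {i j : Fin n} (hij : i ≠ j) {R t : ℝ} (hR : 0 < R)
    (ht : |t| ≤ R) {E : Set (EuclideanSpace ℝ (Fin n))} (hE : MeasurableSet E)
    (hER : E ⊆ Metric.closedBall 0 R) :
    per (E ∩ {x | x i < t}) + ENNReal.ofReal
      (∫ x in E ∩ {x | t ≤ x i}, max (x i - t) 0 ^ 2 / (192 * R ^ 3)) ≤ per E := by
  obtain ⟨W, hW, hWc, hWb, hWE⟩ := exists_bending_field hij hR ht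
  have hH : MeasurableSet {x : EuclideanSpace ℝ (Fin n) | t ≤ x i} :=
    (isClosed_le continuous_const (continuous_coord i)).measurableSet
  have hcont : Continuous fun x : EuclideanSpace ℝ (Fin n) =>
      max (x i - t) 0 ^ 2 / (192 * R ^ 3) := by
    have := continuous_coord i
    fun_prop
  have hint : IntegrableOn (fun x : EuclideanSpace ℝ (Fin n) =>
      max (x i - t) 0 ^ 2 / (192 * R ^ 3)) (E ∩ {x | t ≤ x i}) :=
    (hcont.continuousOn.integrableOn_compact (isCompact_closedBall 0 R)).mono_set
      (Set.inter_subset_left.trans hER)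
  set c := ∫ x in E ∩ {x | t ≤ x i}, max (x i - t) 0 ^ 2 / (192 * R ^ 3)
  have hc0 : 0 ≤ c := integral_nonneg fun x => by positivity
  have hc : c ≤ ∫ x in E ∩ {x | t ≤ x i}, vecDiv W x :=
    setIntegral_mono_on hint (integrable_vecDiv hW hWc).integrableOn (hE.inter hH)
      fun x hx => (hWE x (hER hx.1)).2
  have key : ∀ φ : EuclideanSpace ℝ (Fin n) → EuclideanSpace ℝ (Fin n), ContDiff ℝ 1 φ →
      HasCompactSupport φ → (∀ x, ‖φ x‖ ≤ 1) →
      ENNReal.ofReal ((∫ x in E ∩ {x | x i < t}, vecDiv φ x) + c) ≤ per E :=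
    fun φ h1 h2 h3 => (ENNReal.ofReal_le_ofReal (by gcongr)).trans
      (ofReal_integral_add_integral_le_per hE i t h1 h2 h3 hW hWc hWb
        fun x hx => (hWE x (hER hx)).1)
  have : Nonempty {φ : EuclideanSpace ℝ (Fin n) → EuclideanSpace ℝ (Fin n) //
      ContDiff ℝ 1 φ ∧ HasCompactSupport φ ∧ tsupport φ ⊆ Set.univ ∧ ∀ x, ‖φ x‖ ≤ 1} :=
    ⟨W, hW, hWc, Set.subset_univ _, hWb⟩
  rw [per, perIn, ENNReal.iSup_add]
  refine iSup_le ?_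
  rintro ⟨φ, h1, h2, -, h3⟩
  rcases le_total 0 (∫ x in E ∩ {x | x i < t}, vecDiv φ x) with h | h
  · rw [← ENNReal.ofReal_add h hc0]
    exact key φ h1 h2 h3
  · rw [ENNReal.ofReal_of_nonpos h, zero_add]
    have := key (fun _ => 0) contDiff_const HasCompactSupport.zero (by simp)
    simpa [vecDiv] using this

lemma exists_pos_per_inter_add_le_per {n : ℕ} {i j : Fin n} (hij : i ≠ j) {R : ℝ} (hR : 0 < R)
    {d : ℝ≥0∞} (hd : d ≠ 0) :
    ∃ δ : ℝ≥0∞, δ ≠ 0 ∧ ∀ (E : Set (EuclideanSpace ℝ (Fin n))) (t : ℝ), MeasurableSet E →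
      E ⊆ Metric.closedBall 0 R → |t| ≤ R → d ≤ volume (E ∩ {x | t ≤ x i}) →
      per (E ∩ {x | x i < t}) + δ ≤ per E := by
  rcases eq_or_ne d ⊤ with rfl | hdtop
  · refine ⟨1, one_ne_zero, fun E t _ hER _ h => absurd h (not_le.2 ?_)⟩
    exact (measure_mono (Set.inter_subset_left.trans hER)).trans_lt measure_closedBall_lt_top
  obtain ⟨τ, hτ, hτd⟩ : ∃ τ : ℝ, 0 < τ ∧
      ENNReal.ofReal τ * ENNReal.ofReal (2 * R) ^ (n - 1) ≤ d / 2 := by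
    have h2R : 0 < (2 * R) ^ (n - 1) := by positivity
    have hdr : 0 < (d / 2).toReal :=
      ENNReal.toReal_pos (by simp [hd]) (ENNReal.div_ne_top hdtop two_ne_zero)
    refine ⟨(d / 2).toReal / (2 * R) ^ (n - 1), div_pos hdr h2R, ?_⟩
    rw [← ENNReal.ofReal_pow (by positivity), ← ENNReal.ofReal_mul (by positivity),
      div_mul_cancel₀ _ h2R.ne', ENNReal.ofReal_toReal (ENNReal.div_ne_top hdtop two_ne_zero)]
  have hd2 : 0 < (d / 2).toReal :=
    ENNReal.toReal_pos (by simp [hd]) (ENNReal.div_ne_top hdtop two_ne_zero)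
  refine ⟨ENNReal.ofReal (τ ^ 2 / (192 * R ^ 3) * (d / 2).toReal), ?_, ?_⟩
  · rw [Ne, ENNReal.ofReal_eq_zero, not_le]
    positivity
  intro E t hE hER ht hEd
  refine le_trans ?_ (per_inter_add_le_per hij hR ht hE hER)
  gcongr
  set T := E ∩ {x | t + τ ≤ x i} with hT
  have hTm : MeasurableSet T :=
    hE.inter (isClosed_le continuous_const (continuous_coord i)).measurableSet
  have hTtop : volume T ≠ ⊤ :=
    ((measure_mono (Set.inter_subset_left.trans hER)).trans_lt measure_closedBall_lt_top).ne
  have hTE : T ⊆ E ∩ {x | t ≤ x i} := fun x hx =>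
    ⟨hx.1, le_trans (by linarith : t ≤ t + τ) hx.2⟩
  have hTd : d / 2 ≤ volume T := by
    have hcover : E ∩ {x | t ≤ x i} ⊆
        (Metric.closedBall 0 R ∩ {x | t ≤ x i ∧ x i ≤ t + τ}) ∪ T := fun x hx => by
      rcases le_total (x i) (t + τ) with h | h
      · exact Or.inl ⟨hER hx.1, hx.2, h⟩
      · exact Or.inr ⟨hx.1, h⟩
    have h1 : d ≤ d / 2 + volume T := by
      refine hEd.trans ((measure_mono hcover).trans ((measure_union_le _ _).trans ?_))
      gcongr
      refine (volume_slab_le i R t (t + τ)).trans ?_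
      simpa using hτd
    refine (ENNReal.add_le_add_iff_left (ENNReal.div_ne_top hdtop two_ne_zero)).1 ?_
    rwa [ENNReal.add_halves]
  have hcont : Continuous fun x : EuclideanSpace ℝ (Fin n) =>
      max (x i - t) 0 ^ 2 / (192 * R ^ 3) := by
    have := continuous_coord i
    fun_prop
  have hint : IntegrableOn (fun x : EuclideanSpace ℝ (Fin n) =>
      max (x i - t) 0 ^ 2 / (192 * R ^ 3)) (E ∩ {x | t ≤ x i}) :=
    (hcont.continuousOn.integrableOn_compact (isCompact_closedBall 0 R)).mono_set
      (Set.inter_subset_left.trans hER)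
  calc τ ^ 2 / (192 * R ^ 3) * (d / 2).toReal ≤ τ ^ 2 / (192 * R ^ 3) * volume.real T := by
        gcongr
        exact ENNReal.toReal_mono hTtop hTd
    _ ≤ ∫ x in T, max (x i - t) 0 ^ 2 / (192 * R ^ 3) := by
        refine setIntegral_ge_of_const_le_real hTm hTtop (fun x hx => ?_) (hint.mono_set hTE)
        gcongr
        exact le_max_of_le_left (by linarith [show t + τ ≤ x i from hx.2])
    _ ≤ _ := setIntegral_mono_set hint (Filter.Eventually.of_forall fun x => by positivity)
        hTE.eventuallyLE

lemma exists_volume_inter_eq {n : ℕ} (i : Fin n) {R : ℝ} (hR : 0 < R)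
    {E : Set (EuclideanSpace ℝ (Fin n))} (hER : E ⊆ Metric.closedBall 0 R)
    {A : ℝ≥0∞} (hA : A < volume E) :
    ∃ t : ℝ, |t| ≤ R ∧ volume (E ∩ {x | x i < t}) = A := by
  have hfin : ∀ s : Set (EuclideanSpace ℝ (Fin n)), volume (E ∩ s) ≠ ⊤ := fun s =>
    ((measure_mono (Set.inter_subset_left.trans hER)).trans_lt measure_closedBall_lt_top).ne
  set g : ℝ → ℝ := fun t => volume.real (E ∩ {x | x i < t}) with hg
  have hLip : ∀ s t, g s ≤ g t + (2 * R).toNNReal ^ (n - 1) * dist s t := by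
    intro s t
    have hcover : E ∩ {x | x i < s} ⊆
        (E ∩ {x | x i < t}) ∪ (Metric.closedBall 0 R ∩ {x | t ≤ x i ∧ x i ≤ s}) := fun x hx => by
      rcases lt_or_ge (x i) t with h | h
      · exact Or.inl ⟨hx.1, h⟩
      · exact Or.inr ⟨hER hx.1, h, le_of_lt hx.2⟩
    have h1 : volume (E ∩ {x | x i < s}) ≤ volume (E ∩ {x | x i < t}) +
        ENNReal.ofReal (dist s t) * ENNReal.ofReal (2 * R) ^ (n - 1) := by
      refine (measure_mono hcover).trans ((measure_union_le _ _).trans ?_)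
      gcongr
      refine (volume_slab_le i R t s).trans ?_
      gcongr
      exact le_abs_self _
    have htop : ENNReal.ofReal (dist s t) * ENNReal.ofReal (2 * R) ^ (n - 1) ≠ ⊤ :=
      ENNReal.mul_ne_top ENNReal.ofReal_ne_top (ENNReal.pow_ne_top ENNReal.ofReal_ne_top)
    have h2 := ENNReal.toReal_mono (ENNReal.add_ne_top.2 ⟨hfin _, htop⟩) h1
    rw [ENNReal.toReal_add (hfin _) htop, ENNReal.toReal_mul, ENNReal.toReal_pow,
      ENNReal.toReal_ofReal dist_nonneg] at h2
    rw [mul_comm]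
    exact h2
  have hcont : Continuous g :=
    (LipschitzWith.of_le_add_mul ((2 * R).toNNReal ^ (n - 1)) (by exact_mod_cast hLip)).continuous
  have hcoord : ∀ x ∈ E, -R ≤ x i ∧ x i ≤ R := fun x hx =>
    abs_le.1 ((PiLp.norm_apply_le x i).trans (mem_closedBall_zero_iff.1 (hER hx)))
  have hleft : g (-R) ≤ A.toReal := by
    have : E ∩ {x | x i < -R} = ∅ := by
      ext x
      simpa using fun hx => (hcoord x hx).1
    simp [hg, this]
  have hEtop : volume E ≠ ⊤ := by simpa using hfin Set.univ
  have hright : A.toReal ≤ g R := by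
    have h1 : volume E ≤ volume (E ∩ {x | x i < R}) := by
      have hcover : E ⊆ (E ∩ {x | x i < R}) ∪
          (Metric.closedBall 0 R ∩ {x | R ≤ x i ∧ x i ≤ R}) := fun x hx => by
        rcases lt_or_ge (x i) R with h | h
        · exact Or.inl ⟨hx, h⟩
        · exact Or.inr ⟨hER hx, h, (hcoord x hx).2⟩
      have h0 := volume_slab_le i R R R
      simp only [sub_self, ENNReal.ofReal_zero, zero_mul, nonpos_iff_eq_zero] at h0
      simpa [h0] using (measure_mono (μ := volume) hcover).trans (measure_union_le _ _)
    exact ENNReal.toReal_mono (hfin _) (hA.le.trans h1)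
  obtain ⟨t, ht, hgt⟩ := intermediate_value_Icc (by linarith : -R ≤ R) hcont.continuousOn
    ⟨hleft, hright⟩
  exact ⟨t, abs_le.2 ht, (ENNReal.toReal_eq_toReal_iff' (hfin _) (hA.trans_le le_top).ne).1 hgt⟩

lemma exists_integral_vecDiv_box_le {m : ℕ} {a b : Fin (m + 1) → ℝ} (hab : a ≤ b) :
    ∃ C : ℝ, ∀ φ : EuclideanSpace ℝ (Fin (m + 1)) → EuclideanSpace ℝ (Fin (m + 1)),
      ContDiff ℝ 1 φ → (∀ x, ‖φ x‖ ≤ 1) →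
      ∫ x in WithLp.ofLp ⁻¹' Set.Icc a b, vecDiv φ x ≤ C := by
  refine ⟨∑ i : Fin (m + 1), (1 * volume.real (Set.Icc (a ∘ i.succAbove) (b ∘ i.succAbove)) +
    1 * volume.real (Set.Icc (a ∘ i.succAbove) (b ∘ i.succAbove))), fun φ hφ hb => ?_⟩
  let L : (Fin (m + 1) → ℝ) ≃L[ℝ] EuclideanSpace ℝ (Fin (m + 1)) :=
    (EuclideanSpace.equiv (Fin (m + 1)) ℝ).symm
  obtain ⟨f', hd, hdiv⟩ : ∃ f' : Fin (m + 1) → (Fin (m + 1) → ℝ) → (Fin (m + 1) → ℝ) →L[ℝ] ℝ,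
      (∀ y i, HasFDerivAt (fun y => φ (L y) i) (f' i y) y) ∧
      ∀ y, ∑ i, f' i y (Pi.single i 1) = vecDiv φ (L y) :=
    ⟨fun i y => (EuclideanSpace.proj (𝕜 := ℝ) i).comp
        ((fderiv ℝ φ (L y)).comp (L : (Fin (m + 1) → ℝ) →L[ℝ] _)),
      fun y i => (EuclideanSpace.proj (𝕜 := ℝ) i).hasFDerivAt.comp y
        ((hφ.differentiable one_ne_zero (L y)).hasFDerivAt.comp y L.hasFDerivAt),
      fun _ => rfl⟩
  have hcont : Continuous fun y => vecDiv φ (L y) := (continuous_vecDiv hφ).comp L.continuous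
  have hcoord : ∀ i, ContinuousOn (fun y => φ (L y) i) (Set.Icc a b) := fun i =>
    ((continuous_coord i).comp (hφ.continuous.comp L.continuous)).continuousOn
  have hint : IntegrableOn (fun y => ∑ i, f' i y (Pi.single i 1)) (Set.Icc a b) := by
    simp only [hdiv]
    exact hcont.continuousOn.integrableOn_compact isCompact_Icc
  have hdt := integral_divergence_of_hasFDerivAt_off_countable' a b hab (fun i y => φ (L y) i)
    f' ∅ Set.countable_empty hcoord (fun y _ i => hd y i) hint
  simp only [hdiv] at hdt
  have hpre := (PiLp.volume_preserving_ofLp (Fin (m + 1))).setIntegral_preimage_emb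
    (EuclideanSpace.equiv (Fin (m + 1)) ℝ).toHomeomorph.measurableEmbedding
    (fun y => vecDiv φ (L y)) (Set.Icc a b)
  have hface : ∀ (s : Set (Fin m → ℝ)) (i : Fin (m + 1)) (g : (Fin m → ℝ) → Fin (m + 1) → ℝ),
      volume s < ⊤ → |∫ y in s, φ (L (g y)) i| ≤ 1 * volume.real s := fun s i g hs =>
    norm_setIntegral_le_of_norm_le_const hs fun y _ =>
      (PiLp.norm_apply_le (φ (L (g y))) i).trans (hb _)
  calc ∫ x in WithLp.ofLp ⁻¹' Set.Icc a b, vecDiv φ x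
      = ∫ y in Set.Icc a b, vecDiv φ (L y) := hpre
    _ ≤ _ := by
      rw [hdt]
      refine Finset.sum_le_sum fun i _ => ?_
      have hs : volume (Set.Icc (a ∘ i.succAbove) (b ∘ i.succAbove)) < ⊤ :=
        isCompact_Icc.measure_lt_top
      have h1 := (abs_le.1 (hface _ i (fun y => i.insertNth (b i) y) hs)).2
      have h2 := (abs_le.1 (hface _ i (fun y => i.insertNth (a i) y) hs)).1
      linarith

lemma closedBall_pi_eq_Icc {ι : Type*} [Fintype ι] (x : ι → ℝ) {r : ℝ} (hr : 0 ≤ r) :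
    Metric.closedBall x r = Set.Icc (fun i => x i - r) (fun i => x i + r) := by
  rw [closedBall_pi _ hr, ← Set.pi_univ_Icc]
  simp only [Real.closedBall_eq_Icc]

lemma exists_subset_per_lt_top {m : ℕ} {G : Set (EuclideanSpace ℝ (Fin (m + 1)))}
    (hG : IsOpen G) {A : ℝ≥0∞} (hA : A < volume G) :
    ∃ K ⊆ G, MeasurableSet K ∧ A < volume K ∧ per K < ⊤ := by
  set G' : Set (Fin (m + 1) → ℝ) := WithLp.toLp 2 ⁻¹' G with hG'
  have hG'o : IsOpen G' := hG.preimage (PiLp.continuous_toLp 2 _)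
  have hvol : volume G' = volume G :=
    (PiLp.volume_preserving_toLp (Fin (m + 1))).measure_preimage hG.measurableSet.nullMeasurableSet
  obtain ⟨T, r, hTc, -, hTr, hTG, hTd⟩ := Besicovitch.exists_disjoint_closedBall_covering_ae
    (volume : Measure (Fin (m + 1) → ℝ)) (fun x => {r | Metric.closedBall x r ⊆ G'}) G'
    (fun x hx δ hδ => by
      obtain ⟨ε, hε, hεG⟩ := Metric.nhds_basis_closedBall.mem_iff.1 (hG'o.mem_nhds hx)
      have hmin : 0 < min ε (δ / 2) := lt_min hε (by linarith)
      exact ⟨min ε (δ / 2), (Metric.closedBall_subset_closedBall (min_le_left _ _)).trans hεG,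
        hmin, (min_le_right _ _).trans_lt (by linarith)⟩)
    (fun _ => 1) (fun _ _ => one_pos)
  have hlt : A < ∑' x : T, volume (Metric.closedBall (x : Fin (m + 1) → ℝ) (r x)) := by
    rw [← measure_biUnion hTc hTd fun x _ => Metric.isClosed_closedBall.measurableSet]
    refine (hvol ▸ hA).trans_le (measure_mono_ae ?_)
    exact ae_le_set.2 hTG
  rw [ENNReal.tsum_eq_iSup_sum] at hlt
  obtain ⟨s, hs⟩ := lt_iSup_iff.1 hlt
  let Q : T → Set (EuclideanSpace ℝ (Fin (m + 1))) := fun x =>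
    WithLp.ofLp ⁻¹' Metric.closedBall (x : Fin (m + 1) → ℝ) (r x)
  have hQm : ∀ x ∈ s, MeasurableSet (Q x) := fun x _ =>
    (PiLp.volume_preserving_ofLp (Fin (m + 1))).measurable Metric.isClosed_closedBall.measurableSet
  have hQd : Set.Pairwise (s : Set T) (Function.onFun Disjoint Q) := fun x _ y _ hxy =>
    (hTd x.2 y.2 (Subtype.coe_injective.ne hxy)).preimage _
  refine ⟨⋃ x ∈ s, Q x, ?_, s.measurableSet_biUnion hQm, ?_, ?_⟩
  · exact Set.iUnion₂_subset fun x _ y hy => (hTr x x.2).1 hy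
  · rw [measure_biUnion_finset hQd hQm]
    refine hs.trans_le (Finset.sum_le_sum fun x _ => ?_)
    exact ((PiLp.volume_preserving_ofLp (Fin (m + 1))).measure_preimage
      Metric.isClosed_closedBall.measurableSet.nullMeasurableSet).ge
  · have hbox : ∀ x : T, ∃ C : ℝ,
        ∀ φ : EuclideanSpace ℝ (Fin (m + 1)) → EuclideanSpace ℝ (Fin (m + 1)),
        ContDiff ℝ 1 φ → (∀ x, ‖φ x‖ ≤ 1) → ∫ y in Q x, vecDiv φ y ≤ C := fun x => by
      have hr : 0 < r x := (hTr x x.2).2.1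
      simp only [Q, closedBall_pi_eq_Icc (x : Fin (m + 1) → ℝ) hr.le]
      exact exists_integral_vecDiv_box_le fun i => by linarith
    choose C hC using hbox
    refine lt_of_le_of_lt (iSup_le ?_) (ENNReal.ofReal_lt_top (r := ∑ x ∈ s, C x))
    rintro ⟨φ, h1, h2, -, h3⟩
    refine ENNReal.ofReal_le_ofReal ?_
    rw [integral_biUnion_finset s hQm hQd fun x _ => (integrable_vecDiv h1 h2).integrableOn]
    exact Finset.sum_le_sum fun x _ => hC x φ h1 h3

lemma isoProfile_lt_top {m : ℕ} {i j : Fin (m + 1)} (hij : i ≠ j)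
    {G : Set (EuclideanSpace ℝ (Fin (m + 1)))} (hG : IsOpen G) {R : ℝ} (hR : 0 < R)
    (hGR : closure G ⊆ Metric.closedBall 0 R) {A : ℝ≥0∞} (hA : A < volume G) :
    isoProfile G A < ⊤ := by
  obtain ⟨K, hKG, hKm, hKA, hKper⟩ := exists_subset_per_lt_top hG hA
  have hKR : K ⊆ Metric.closedBall 0 R := hKG.trans (subset_closure.trans hGR)
  obtain ⟨t, ht, htA⟩ := exists_volume_inter_eq i hR hKR hKA
  refine lt_of_le_of_lt (sInf_le ⟨K ∩ {x | x i < t}, ?_, ?_, htA, rfl⟩)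
    ((le_self_add.trans (per_inter_add_le_per hij hR ht hKm hKR)).trans_lt hKper)
  · exact hKm.inter (isOpen_lt (continuous_coord i) continuous_const).measurableSet
  · exact Set.inter_subset_left.trans (hKG.trans subset_closure)

/-- On a bounded subregion the isoperimetric profile is strictly increasing. -/
theorem isoProfile_strictMono (n : ℕ) (hn : 2 ≤ n)
    (G : Set (EuclideanSpace ℝ (Fin n))) (hGopen : IsOpen G)
    (hGnull : volume (frontier G) = 0) (hGbdd : Bornology.IsBounded G) :
    ∀ A A' : ℝ≥0∞, A < A' → A' < volume G → isoProfile G A < isoProfile G A' := by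
  intro A A' hAA' hA'
  obtain ⟨m, rfl⟩ : ∃ m, n = m + 2 := ⟨n - 2, by omega⟩
  obtain ⟨R, hR, hGR⟩ := hGbdd.closure.subset_closedBall_lt 0 0
  have hij : (0 : Fin (m + 2)) ≠ 1 := by simp
  obtain ⟨δ, hδ, hcut⟩ :=
    exists_pos_per_inter_add_le_per hij hR (tsub_pos_of_lt hAA').ne'
  have hfin := isoProfile_lt_top hij hGopen hR hGR (hAA'.trans hA')
  refine (ENNReal.lt_add_right hfin.ne hδ).trans_le (le_sInf ?_)
  rintro _ ⟨E, hEm, hEG, hEA, rfl⟩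
  have hER := hEG.trans hGR
  obtain ⟨t, ht, htA⟩ := exists_volume_inter_eq 0 hR hER (hEA ▸ hAA')
  have hH : MeasurableSet {x : EuclideanSpace ℝ (Fin (m + 2)) | x 0 < t} :=
    (isOpen_lt (continuous_coord 0) continuous_const).measurableSet
  refine le_trans ?_ (hcut E t hEm hER ht ?_)
  · gcongr
    exact sInf_le ⟨_, hEm.inter hH, Set.inter_subset_left.trans hEG, htA, rfl⟩
  · rw [tsub_le_iff_left, ← htA, ← hEA, ← measure_inter_add_sdiff E hH,
      show E \ {x | x 0 < t} = E ∩ {x | t ≤ x 0} by ext; simp]
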